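/- For each natural number k, let ψ_k : ℚ[v₁, …, v₇] → ℚ[x₁, x₂] be the ℚ-algebra homomorphism determined by ψ_k(v₁) = 0, ψ_k(v₂) = 0, ψ_k(v₃) = 8k²x₁² − 8kx₁x₂ + 4x₁² + 4x₂², ψ_k(v₄) = 32k⁴x₁⁴ − 64k³x₁³x₂ + 16k²x₁⁴ + 48k²x₁²x₂² − 16kx₁³x₂ − 16kx₁x₂³ + 4x₁⁴ + 8x₁²x₂² + 4x₂⁴, ψ_k(v₅) = 8k²x₁⁴ − 8kx₁³x₂ + 4x₁²x₂², ψ_k(v₆) = 32k⁴x₁⁶ − 64k³x₁⁵x₂ + 8k²x₁⁶ + 48k²x₁⁴x₂² − 8kx₁⁵x₂ − 16kx₁³x₂³ + 4x₁⁴x₂² + 4x₁²x₂⁴, and ψ_k(v₇) = 32k⁴x₁⁸ − 64k³x₁⁷x₂ + 48k²x₁⁶x₂² − 16kx₁⁵x₂³ + 4x₁⁴x₂⁴. Let U := ⋂_{k ∈ ℕ} ker(ψ_k). Then the quotient ring ℚ[v₁, …, v₇]/U has Krull dimension 3. -/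

import Mathlib

open MvPolynomial

set_option synthInstance.maxHeartbeats 1000000
set_option maxHeartbeats 1000000

/-- The ℚ-algebra map `ψ_k : ℚ[v₁,…,v₇] → ℚ[x₁,x₂]` (with `x₁ = X 0`, `x₂ = X 1`)
coming from equivariant localisation for the `k`-th torus action on `S² × S²`. -/
noncomputable def psi (k : ℕ) : MvPolynomial (Fin 7) ℚ →ₐ[ℚ] MvPolynomial (Fin 2) ℚ :=
  MvPolynomial.aeval
    ![0, 0,
      8 * (k : MvPolynomial (Fin 2) ℚ) ^ 2 * X 0 ^ 2
        - 8 * (k : MvPolynomial (Fin 2) ℚ) * X 0 * X 1 + 4 * X 0 ^ 2 + 4 * X 1 ^ 2,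
      32 * (k : MvPolynomial (Fin 2) ℚ) ^ 4 * X 0 ^ 4
        - 64 * (k : MvPolynomial (Fin 2) ℚ) ^ 3 * X 0 ^ 3 * X 1
        + 16 * (k : MvPolynomial (Fin 2) ℚ) ^ 2 * X 0 ^ 4
        + 48 * (k : MvPolynomial (Fin 2) ℚ) ^ 2 * X 0 ^ 2 * X 1 ^ 2
        - 16 * (k : MvPolynomial (Fin 2) ℚ) * X 0 ^ 3 * X 1
        - 16 * (k : MvPolynomial (Fin 2) ℚ) * X 0 * X 1 ^ 3
        + 4 * X 0 ^ 4 + 8 * X 0 ^ 2 * X 1 ^ 2 + 4 * X 1 ^ 4,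
      8 * (k : MvPolynomial (Fin 2) ℚ) ^ 2 * X 0 ^ 4
        - 8 * (k : MvPolynomial (Fin 2) ℚ) * X 0 ^ 3 * X 1 + 4 * X 0 ^ 2 * X 1 ^ 2,
      32 * (k : MvPolynomial (Fin 2) ℚ) ^ 4 * X 0 ^ 6
        - 64 * (k : MvPolynomial (Fin 2) ℚ) ^ 3 * X 0 ^ 5 * X 1
        + 8 * (k : MvPolynomial (Fin 2) ℚ) ^ 2 * X 0 ^ 6
        + 48 * (k : MvPolynomial (Fin 2) ℚ) ^ 2 * X 0 ^ 4 * X 1 ^ 2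
        - 8 * (k : MvPolynomial (Fin 2) ℚ) * X 0 ^ 5 * X 1
        - 16 * (k : MvPolynomial (Fin 2) ℚ) * X 0 ^ 3 * X 1 ^ 3
        + 4 * X 0 ^ 4 * X 1 ^ 2 + 4 * X 0 ^ 2 * X 1 ^ 4,
      32 * (k : MvPolynomial (Fin 2) ℚ) ^ 4 * X 0 ^ 8
        - 64 * (k : MvPolynomial (Fin 2) ℚ) ^ 3 * X 0 ^ 7 * X 1
        + 48 * (k : MvPolynomial (Fin 2) ℚ) ^ 2 * X 0 ^ 6 * X 1 ^ 2
        - 16 * (k : MvPolynomial (Fin 2) ℚ) * X 0 ^ 5 * X 1 ^ 3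
        + 4 * X 0 ^ 4 * X 1 ^ 4]

/-- Integral injective ring maps preserve Krull dimension. -/
theorem krullDim_eq_of_integral {R S : Type*} [CommRing R] [CommRing S] (f : R →+* S)
    (hf : f.IsIntegral) (hinj : Function.Injective f) : ringKrullDim R = ringKrullDim S := by
  have hs := hf.comap_surjective hinj
  algebraize [f]
  apply le_antisymm
  · refine iSup_le fun l => ?_
    obtain ⟨P, hP⟩ := hs (RelSeries.head l)
    have : P.asIdeal.LiesOver (RelSeries.head l).asIdeal := ⟨by rw [← hP]; rfl⟩
    obtain ⟨L, hL, -⟩ := Ideal.exists_ltSeries_of_hasGoingUp l P.asIdeal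
    rw [← hL]
    exact Order.LTSeries.length_le_krullDim L
  · refine Order.krullDim_le_of_strictMono (PrimeSpectrum.comap (algebraMap R S)) ?_
    intro I J h
    exact Ideal.IsIntegral.comap_lt_comap (R := R) (I := I.asIdeal) (J := J.asIdeal) h

/-- The generic version of the maps `psi k`: the variables of the target are
`x₁`, `x₂` and `z = 2 k x₁ - x₂`. -/
noncomputable def Psi : MvPolynomial (Fin 7) ℚ →ₐ[ℚ] MvPolynomial (Fin 3) ℚ :=
  MvPolynomial.aeval
    ![0, 0,
      2 * (X 0 ^ 2 + X 1 ^ 2) + 2 * (X 0 ^ 2 + X 2 ^ 2),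
      2 * (X 0 ^ 2 + X 1 ^ 2) ^ 2 + 2 * (X 0 ^ 2 + X 2 ^ 2) ^ 2,
      2 * (X 0 ^ 2 * X 1 ^ 2) + 2 * (X 0 ^ 2 * X 2 ^ 2),
      2 * (X 0 ^ 2 * X 1 ^ 2) * (X 0 ^ 2 + X 1 ^ 2)
        + 2 * (X 0 ^ 2 * X 2 ^ 2) * (X 0 ^ 2 + X 2 ^ 2),
      2 * (X 0 ^ 2 * X 1 ^ 2) ^ 2 + 2 * (X 0 ^ 2 * X 2 ^ 2) ^ 2]

/-- Specialisation `z = 2 k x₁ - x₂`. -/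
noncomputable def spec (k : ℕ) : MvPolynomial (Fin 3) ℚ →ₐ[ℚ] MvPolynomial (Fin 2) ℚ :=
  MvPolynomial.aeval ![X 0, X 1, 2 * (k : MvPolynomial (Fin 2) ℚ) * X 0 - X 1]

theorem psi_eq (k : ℕ) : psi k = (spec k).comp Psi := by
  apply MvPolynomial.algHom_ext
  intro i
  have e : ∀ F : MvPolynomial (Fin 3) ℚ →ₐ[ℚ] MvPolynomial (Fin 2) ℚ, F 2 = 2 :=
    fun F => map_ofNat F 2
  fin_cases i <;> simp [psi, Psi, spec, e] <;> ring

theorem spec_sep (g : MvPolynomial (Fin 3) ℚ) (h : ∀ k, spec k g = 0) : g = 0 := by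
  have key : ∀ a b c : ℚ, a ≠ 0 → eval ![a, b, c] g = 0 := by
    intro a b c ha
    let p : Polynomial ℚ := aeval ![Polynomial.C a, Polynomial.C b, Polynomial.X] g
    have hp : ∀ t : ℚ, p.eval t = eval ![a, b, t] g := by
      intro t
      have : ((Polynomial.aeval t).comp
          (aeval ![Polynomial.C a, Polynomial.C b, Polynomial.X]) :
            MvPolynomial (Fin 3) ℚ →ₐ[ℚ] ℚ) = aeval ![a, b, t] := by
        apply MvPolynomial.algHom_ext
        intro i
        fin_cases i <;> simp [aeval_X]
      have h2 := DFunLike.congr_fun this g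
      simpa [p, Polynomial.coe_aeval_eq_eval, MvPolynomial.coe_aeval_eq_eval] using h2
    have hz : ∀ k : ℕ, p.eval (2 * (k : ℚ) * a - b) = 0 := by
      intro k
      rw [hp]
      have : ((aeval ![a, b]).comp (spec k) :
            MvPolynomial (Fin 3) ℚ →ₐ[ℚ] ℚ) = aeval ![a, b, 2 * (k : ℚ) * a - b] := by
        apply MvPolynomial.algHom_ext
        intro i
        fin_cases i <;> simp [aeval_X, spec]
      have h2 := DFunLike.congr_fun this g
      rw [AlgHom.comp_apply, h k, map_zero] at h2
      rw [MvPolynomial.aeval_eq_eval] at h2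
      exact h2.symm
    have p0 : p = 0 := by
      apply Polynomial.eq_zero_of_infinite_isRoot
      refine Set.Infinite.mono (s := Set.range fun k : ℕ => 2 * (k : ℚ) * a - b) ?_ ?_
      · rintro _ ⟨k, rfl⟩
        exact hz k
      · apply Set.infinite_range_of_injective
        intro k l hkl
        have h3 : (k : ℚ) * a = l * a := by
          simp only at hkl
          linarith
        exact_mod_cast mul_right_cancel₀ ha h3
    rw [← hp, p0, Polynomial.eval_zero]
  have hx : (X 0 : MvPolynomial (Fin 3) ℚ) * g = 0 := by
    apply MvPolynomial.funext
    intro v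
    rw [map_mul, eval_X, map_zero]
    by_cases hv : v 0 = 0
    · rw [hv, zero_mul]
    · have h4 := key (v 0) (v 1) (v 2) hv
      have h5 : ![v 0, v 1, v 2] = v := by
        ext i
        fin_cases i <;> rfl
      rw [h5] at h4
      rw [h4, mul_zero]
  exact (mul_eq_zero.mp hx).resolve_left (X_ne_zero 0)

theorem ker_eq : (⨅ k : ℕ, RingHom.ker (psi k)) = RingHom.ker Psi.toRingHom := by
  ext f
  rw [Ideal.mem_iInf]
  simp only [RingHom.mem_ker]
  constructor
  · intro h
    apply spec_sep
    intro k
    have := h k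
    rw [psi_eq] at this
    exact this
  · intro h k
    rw [psi_eq, AlgHom.comp_apply]
    have : Psi f = 0 := h
    rw [this, map_zero]

theorem Psi_integral : Psi.toRingHom.IsIntegral := by
  let f := Psi.toRingHom
  let _ : Algebra (MvPolynomial (Fin 7) ℚ) (MvPolynomial (Fin 3) ℚ) := f.toAlgebra
  let N := integralClosure (MvPolynomial (Fin 7) ℚ) (MvPolynomial (Fin 3) ℚ)
  have hN : ∀ r, Psi r ∈ N := fun r => N.algebraMap_mem r
  have hpow : ∀ y, y ^ 2 ∈ N → y ∈ N := fun y hy => IsIntegral.of_pow two_pos hy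
  have hC : ∀ c : ℚ, C c ∈ N := fun c => by
    have := hN (C c)
    rwa [show Psi (C c) = C c from Psi.commutes c] at this
  have h2 := hN (X 2)
  have h3 := hN (X 3)
  have h4 := hN (X 4)
  simp only [Psi, aeval_X] at h2 h3 h4
  simp at h2 h3 h4
  have cc : ∀ (c d : ℚ), c * d = 1 → (C c * C d : MvPolynomial (Fin 3) ℚ) = 1 := by
    intro c d h
    rw [← C_mul, h, C_1]
  have c2 : (C 2 : MvPolynomial (Fin 3) ℚ) = 2 := rfl
  have c4 : (C 4 : MvPolynomial (Fin 3) ℚ) = 4 := rfl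
  have c8 : (C 8 : MvPolynomial (Fin 3) ℚ) = 8 := rfl
  have c16 : (C 16 : MvPolynomial (Fin 3) ℚ) = 16 := rfl
  have q4 := cc 4 (1/4) (by norm_num)
  have q8 := cc 8 (1/8) (by norm_num)
  rw [c4] at q4
  rw [c8] at q8
  -- `4 A - 2 (B + C)`
  have e1 : (4 * X 0 ^ 2 - 2 * (X 1 ^ 2 + X 2 ^ 2) : MvPolynomial (Fin 3) ℚ) ∈ N := by
    apply hpow
    convert sub_mem (N.pow_mem h2 2) (N.mul_mem (hC 16) h4) using 1
    rw [c16]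
    ring
  have eA : (X 0 ^ 2 : MvPolynomial (Fin 3) ℚ) ∈ N := by
    convert N.mul_mem (hC (1/8)) (add_mem h2 e1) using 1
    linear_combination (- X 0 ^ 2) * q8
  have eD : (X 1 ^ 2 - X 2 ^ 2 : MvPolynomial (Fin 3) ℚ) ∈ N := by
    apply hpow
    convert sub_mem h3 (N.mul_mem (hC (1/4)) (N.pow_mem h2 2)) using 1
    linear_combination (2 * X 0 ^ 2 + X 1 ^ 2 + X 2 ^ 2) ^ 2 * q4
  have eB : (X 1 ^ 2 : MvPolynomial (Fin 3) ℚ) ∈ N := by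
    convert N.mul_mem (hC (1/4)) (add_mem (sub_mem h2 (N.mul_mem (hC 4) eA))
      (N.mul_mem (hC 2) eD)) using 1
    rw [c4, c2]
    linear_combination (- X 1 ^ 2) * q4
  have eC : (X 2 ^ 2 : MvPolynomial (Fin 3) ℚ) ∈ N := by
    convert sub_mem eB eD using 1
    ring
  have hX : ∀ i, (X i : MvPolynomial (Fin 3) ℚ) ∈ N := by
    intro i
    apply hpow
    fin_cases i
    · exact eA
    · exact eB
    · exact eC
  intro g
  change g ∈ N
  induction g using MvPolynomial.induction_on with
  | C a => exact hC a
  | add p q hp hq => exact add_mem hp hq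
  | mul_X p i hp => exact N.mul_mem hp (hX i)

/-- The quotient `ℚ[v₁,…,v₇]/U`, where `U = ⋂_{k ∈ ℕ} ker(ψ_k)`, has Krull
dimension 3. -/
theorem S2S2_all_torus_actions_dim_three :
    ringKrullDim
      (MvPolynomial (Fin 7) ℚ ⧸ ⨅ k : ℕ, RingHom.ker (psi k)) = 3 := by
  rw [ker_eq, krullDim_eq_of_integral (RingHom.kerLift Psi.toRingHom) ?_
    (RingHom.kerLift_injective _), MvPolynomial.ringKrullDim_of_isNoetherianRing]
  · simp
  · apply RingHom.IsIntegral.tower_top (Ideal.Quotient.mk (RingHom.ker Psi.toRingHom))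
    have : (RingHom.kerLift Psi.toRingHom).comp
        (Ideal.Quotient.mk (RingHom.ker Psi.toRingHom)) = Psi.toRingHom := by
      exact RingHom.ext fun x => RingHom.kerLift_mk Psi.toRingHom x
    rw [this]
    exact Psi_integral
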